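/- arXiv:2308.10238 — 5 statements merged into one kernel-verified Lean document; each statement's English description precedes it below -/
import Mathlib

section
/- Let A be a finite subset of {0,1}^d with |A| ≥ 2, let π* ∈ A, and assume that for every s ∈ {1,…,d} there exists π ∈ A with π_s ≠ π*_s. Define U_s = max over π' ∈ A and π ∈ A with π_s ≠ π*_s of (Σ_{e=1}^d |π_e − π'_e|²)/|π*_s − π_s|², V_s = max over π' ∈ A and π ∈ A with π_s ≠ π*_s of |π_s − π'_s| · (Σ_{e=1}^d |π_e − π'_e|)/|π*_s − π_s|², U = max_{s∈{1,…,d}} U_s, V = max_{s∈{1,…,d}} V_s, and width = max_{π, π' ∈ A} Σ_{s=1}^d |π_s − π'_s|. Then U = V = width. -/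
/-- `U_s`: maximum over `π' ∈ A` and `π ∈ A` with `π s ≠ π* s` of
`(∑ e, |π e - π' e|²) / |π* s - π s|²`. -/
noncomputable def Uconst (d : ℕ) (A : Finset (Fin d → ℝ)) (πstar : Fin d → ℝ)
    (s : Fin d) : ℝ :=
  sSup {x : ℝ | ∃ π' ∈ A, ∃ π ∈ A, π s ≠ πstar s ∧
    x = (∑ e, |π e - π' e| ^ 2) / |πstar s - π s| ^ 2}

/-- `V_s`: maximum over `π' ∈ A` and `π ∈ A` with `π s ≠ π* s` of
`|π s - π' s| · (∑ e, |π e - π' e|) / |π* s - π s|²`. -/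
noncomputable def Vconst (d : ℕ) (A : Finset (Fin d → ℝ)) (πstar : Fin d → ℝ)
    (s : Fin d) : ℝ :=
  sSup {x : ℝ | ∃ π' ∈ A, ∃ π ∈ A, π s ≠ πstar s ∧
    x = |π s - π' s| * (∑ e, |π e - π' e|) / |πstar s - π s| ^ 2}

/-- The width of the action set: `max_{π, π' ∈ A} ∑ s, |π s - π' s|`. -/
noncomputable def width (d : ℕ) (A : Finset (Fin d → ℝ)) : ℝ :=
  sSup {x : ℝ | ∃ π ∈ A, ∃ π' ∈ A, x = ∑ s, |π s - π' s|}

theorem iSup_sSup_eq_of_mem_of_le {ι : Type*} {S : ι → Set ℝ} {w : ℝ}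
    (hne : ∀ i, (S i).Nonempty) (hle : ∀ i, ∀ x ∈ S i, x ≤ w) (hmem : ∃ i, w ∈ S i) :
    ⨆ i, sSup (S i) = w := by
  obtain ⟨i, hi⟩ := hmem
  have : Nonempty ι := ⟨i⟩
  have hsup : ∀ j, sSup (S j) ≤ w := fun j => csSup_le (hne j) (hle j)
  refine le_antisymm (ciSup_le hsup) ?_
  exact (le_csSup ⟨w, hle i⟩ hi).trans (le_ciSup ⟨w, Set.forall_mem_range.2 hsup⟩ i)

theorem isGreatest_width {d : ℕ} {A : Finset (Fin d → ℝ)} (hA : A.Nonempty) :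
    IsGreatest {x : ℝ | ∃ π ∈ A, ∃ π' ∈ A, x = ∑ s, |π s - π' s|} (width d A) := by
  have hset : {x : ℝ | ∃ π ∈ A, ∃ π' ∈ A, x = ∑ s, |π s - π' s|} =
      (fun p : (Fin d → ℝ) × (Fin d → ℝ) => ∑ s, |p.1 s - p.2 s|) '' ↑(A ×ˢ A) := by
    ext x
    simp only [Set.mem_ofPred_eq, Set.mem_image, Finset.mem_coe, Finset.mem_product, Prod.exists]
    grind
  have hfin : {x : ℝ | ∃ π ∈ A, ∃ π' ∈ A, x = ∑ s, |π s - π' s|}.Finite := by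
    rw [hset]
    exact (A ×ˢ A).finite_toSet.image _
  obtain ⟨a, ha⟩ := hA
  exact ⟨Set.Nonempty.csSup_mem ⟨_, a, ha, a, ha, rfl⟩ hfin,
    fun x hx => le_csSup hfin.bddAbove hx⟩

theorem abs_sub_eq_one_of_binary {x y : ℝ} (hx : x = 0 ∨ x = 1) (hy : y = 0 ∨ y = 1)
    (hxy : x ≠ y) : |x - y| = 1 := by
  rcases hx with rfl | rfl <;> rcases hy with rfl | rfl <;> simp_all

theorem abs_sub_sq_of_binary {x y : ℝ} (hx : x = 0 ∨ x = 1) (hy : y = 0 ∨ y = 1) :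
    |x - y| ^ 2 = |x - y| := by
  rcases hx with rfl | rfl <;> rcases hy with rfl | rfl <;> simp

theorem abs_sub_le_one_of_binary {x y : ℝ} (hx : x = 0 ∨ x = 1) (hy : y = 0 ∨ y = 1) :
    |x - y| ≤ 1 := by
  rcases hx with rfl | rfl <;> rcases hy with rfl | rfl <;> simp

/-- The width is attained at a pair differing in a coordinate where the first member disagrees
with the distinguished action. -/
theorem exists_width_eq {d : ℕ} {A : Finset (Fin d → ℝ)} (hcard : 2 ≤ A.card)
    (πstar : Fin d → ℝ) :
    ∃ π ∈ A, ∃ π' ∈ A, ∃ s, π s ≠ πstar s ∧ π s ≠ π' s ∧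
      width d A = ∑ e, |π e - π' e| := by
  have hone : 1 < A.card := hcard
  have hgreatest := isGreatest_width (Finset.card_pos.1 (zero_lt_one.trans hone))
  obtain ⟨u, hu, v, hv, huv⟩ := Finset.one_lt_card.1 hone
  obtain ⟨a, ha, b, hb, hab⟩ := hgreatest.1
  have hpos : 0 < width d A := by
    obtain ⟨s, hs⟩ := Function.ne_iff.1 huv
    refine lt_of_lt_of_le ?_ (hgreatest.2 ⟨u, hu, v, hv, rfl⟩)
    exact Finset.sum_pos' (fun e _ => abs_nonneg _)
      ⟨s, Finset.mem_univ s, abs_pos.2 (sub_ne_zero.2 hs)⟩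
  have hne : a ≠ b := by
    rintro rfl
    simp [hab] at hpos
  obtain ⟨s, hs⟩ := Function.ne_iff.1 hne
  by_cases has : a s = πstar s
  · refine ⟨b, hb, a, ha, s, fun h => hs (has.trans h.symm), hs.symm, ?_⟩
    simpa only [abs_sub_comm] using hab
  · exact ⟨a, ha, b, hb, s, has, hs, hab⟩

/-- Proposition 2 of the paper: in the ordinary CPE-MAB (actions in `{0,1}^d`),
`U = V = width`, where `U = max_s U_s` and `V = max_s V_s`. -/
theorem stmt2 (d : ℕ) (A : Finset (Fin d → ℝ))
    (hbin : ∀ π ∈ A, ∀ s, π s = 0 ∨ π s = 1) (hcard : 2 ≤ A.card)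
    (πstar : Fin d → ℝ) (hπstar : πstar ∈ A)
    (hdiff : ∀ s : Fin d, ∃ π ∈ A, π s ≠ πstar s) :
    (⨆ s : Fin d, Uconst d A πstar s) = width d A
    ∧ (⨆ s : Fin d, Vconst d A πstar s) = width d A := by
  have hgreatest := isGreatest_width ⟨πstar, hπstar⟩
  have hden : ∀ π ∈ A, ∀ s, π s ≠ πstar s → |πstar s - π s| = 1 := fun π hπ s h =>
    abs_sub_eq_one_of_binary (hbin _ hπstar s) (hbin _ hπ s) h.symm
  have hsq : ∀ π ∈ A, ∀ π' ∈ A, ∑ e, |π e - π' e| ^ 2 = ∑ e, |π e - π' e| :=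
    fun π hπ π' hπ' => Finset.sum_congr rfl fun e _ =>
      abs_sub_sq_of_binary (hbin π hπ e) (hbin π' hπ' e)
  obtain ⟨a, ha, b, hb, s, has, hab, hw⟩ := exists_width_eq hcard πstar
  constructor
  · refine iSup_sSup_eq_of_mem_of_le (fun t => ?_) ?_ ⟨s, b, hb, a, ha, has, ?_⟩
    · obtain ⟨π, hπ, h⟩ := hdiff t
      exact ⟨_, πstar, hπstar, π, hπ, h, rfl⟩
    · rintro t x ⟨π', hπ', π, hπ, h, rfl⟩
      rw [hden π hπ t h, hsq π hπ π' hπ', one_pow, div_one]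
      exact hgreatest.2 ⟨π, hπ, π', hπ', rfl⟩
    · rw [hden a ha s has, hsq a ha b hb, one_pow, div_one, hw]
  · refine iSup_sSup_eq_of_mem_of_le (fun t => ?_) ?_ ⟨s, b, hb, a, ha, has, ?_⟩
    · obtain ⟨π, hπ, h⟩ := hdiff t
      exact ⟨_, πstar, hπstar, π, hπ, h, rfl⟩
    · rintro t x ⟨π', hπ', π, hπ, h, rfl⟩
      rw [hden π hπ t h, one_pow, div_one]
      refine le_trans ?_ (hgreatest.2 ⟨π, hπ, π', hπ', rfl⟩)
      exact mul_le_of_le_one_left (Finset.sum_nonneg fun e _ => abs_nonneg _)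
        (abs_sub_le_one_of_binary (hbin π hπ t) (hbin π' hπ' t))
    · rw [hden a ha s has, abs_sub_eq_one_of_binary (hbin a ha s) (hbin b hb s) hab,
        one_pow, div_one, one_mul, hw]
end

section
/- Let A be a finite subset of ℝ^d, let μ ∈ ℝ^d, and let π* ∈ A satisfy μᵀ(π* − π) > 0 for every π ∈ A \ {π*}. Assume for every s ∈ {1,…,d} there exists π ∈ A with π_s ≠ π*_s, and define the G-gap Δ_(s) = min over π ∈ A \ {π*} with π_s ≠ π*_s of μᵀ(π* − π)/|π*_s − π_s| and the hardness measure H = Σ_{s=1}^d 1/Δ_(s)². Then every τ : {1,…,d} → ℝ with τ_s > 0 for all s that satisfies, for every π ∈ A \ {π*}, Σ_{s : π_s ≠ π*_s} |π*_s − π_s|²/τ_s ≤ (μᵀ(π* − π))², must satisfy Σ_{s=1}^d τ_s ≥ H. In particular, the optimal value Low(A) of the mathematical program minimizing Σ_s τ_s over such τ satisfies Low(A) ≥ H. -/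
/-- Appendix claim of the paper: any `τ` feasible for the program `Low(A)`
(program (8)) satisfies `∑ s, τ s ≥ H = ∑ s, 1 / Δ_(s)²`, where
`Δ_(s) = min_{π ∈ A \ {π*}, π s ≠ π* s} μᵀ(π* - π) / |π* s - π s|` is the G-gap.
In particular `Low(A) ≥ H`. -/
theorem stmt6 (d : ℕ) (A : Finset (Fin d → ℝ)) (μ πstar : Fin d → ℝ)
    (hπstar : πstar ∈ A)
    (hopt : ∀ π ∈ A, π ≠ πstar → 0 < ∑ e, μ e * (πstar e - π e))
    (hdiff : ∀ s : Fin d, ∃ π ∈ A, π s ≠ πstar s)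
    (Δ : Fin d → ℝ)
    (hΔ : ∀ s, Δ s = sInf {x : ℝ | ∃ π ∈ A, π ≠ πstar ∧ π s ≠ πstar s ∧
        x = (∑ e, μ e * (πstar e - π e)) / |πstar s - π s|})
    (τ : Fin d → ℝ) (hτ : ∀ s, 0 < τ s)
    (hfeas : ∀ π ∈ A, π ≠ πstar →
        ∑ s ∈ Finset.univ.filter (fun s => π s ≠ πstar s),
            |πstar s - π s| ^ 2 / τ s
          ≤ (∑ e, μ e * (πstar e - π e)) ^ 2) :
    ∑ s, τ s ≥ ∑ s, 1 / Δ s ^ 2 := by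
  refine Finset.sum_le_sum fun s _ => ?_
  set S : Set ℝ := {x : ℝ | ∃ π ∈ A, π ≠ πstar ∧ π s ≠ πstar s ∧
    x = (∑ e, μ e * (πstar e - π e)) / |πstar s - π s|}
  have hfin : S.Finite := by
    refine (A.finite_toSet.image
      fun π => (∑ e, μ e * (πstar e - π e)) / |πstar s - π s|).subset ?_
    rintro x ⟨π, hπ, -, -, rfl⟩
    exact ⟨π, hπ, rfl⟩
  have hne : S.Nonempty := by
    obtain ⟨π, hπ, hs⟩ := hdiff s
    exact ⟨_, π, hπ, fun h => hs (congrFun h s), hs, rfl⟩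
  obtain ⟨π, hπ, hπne, hs, hx⟩ := hne.csInf_mem hfin
  have hgap := hopt π hπ hπne
  have hterm : |πstar s - π s| ^ 2 / τ s ≤ (∑ e, μ e * (πstar e - π e)) ^ 2 :=
    (Finset.single_le_sum (f := fun s => |πstar s - π s| ^ 2 / τ s)
      (fun t _ => div_nonneg (sq_nonneg _) (hτ t).le)
      (Finset.mem_filter.2 ⟨Finset.mem_univ s, hs⟩)).trans (hfeas π hπ hπne)
  rw [hΔ s, hx, div_pow, one_div_div, div_le_iff₀ (pow_pos hgap 2), mul_comm]
  exact (div_le_iff₀ (hτ s)).1 hterm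
end

section
/- Let A be a finite subset of ℝ^d, let μ ∈ ℝ^d, and let π* ∈ A satisfy μᵀ(π* − π) > 0 for every π ∈ A \ {π*}. Assume for every s ∈ {1,…,d} there exists π ∈ A with π_s ≠ π*_s, and define Δ_(s) = min over π ∈ A \ {π*} with π_s ≠ π*_s of μᵀ(π* − π)/|π*_s − π_s|. Then a vector τ : {1,…,d} → ℝ with τ_s > 0 for all s satisfies, for every π ∈ A \ {π*}, max over s with π_s ≠ π*_s of |π*_s − π_s|²/τ_s ≤ (μᵀ(π* − π))², if and only if τ_s ≥ 1/Δ_(s)² for every s. Consequently, the minimum of Σ_{s=1}^d τ_s over all such feasible τ equals Σ_{s=1}^d 1/Δ_(s)² and is attained at τ'_s = Δ_(s)^{-2}. -/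
theorem sSup_setOf_exists_eq_le_iff {ι : Type*} [Finite ι] (p : ι → Prop) (f : ι → ℝ) {c : ℝ}
    (hc : 0 ≤ c) : sSup {x : ℝ | ∃ i, p i ∧ x = f i} ≤ c ↔ ∀ i, p i → f i ≤ c := by
  have hfin : {x : ℝ | ∃ i, p i ∧ x = f i}.Finite :=
    (Set.finite_range f).subset fun _ ⟨i, _, hx⟩ => ⟨i, hx.symm⟩
  constructor
  · intro h i hi
    exact (le_csSup hfin.bddAbove ⟨i, hi, rfl⟩).trans h
  · intro h
    refine Real.sSup_le ?_ hc
    rintro _ ⟨i, hi, rfl⟩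
    exact h i hi

theorem isLeast_sInf_setOf_exists_mem_eq {α : Type*} (A : Finset α) (p q : α → Prop) (f : α → ℝ)
    (h : ∃ a ∈ A, p a ∧ q a) :
    IsLeast {x : ℝ | ∃ a ∈ A, p a ∧ q a ∧ x = f a}
      (sInf {x : ℝ | ∃ a ∈ A, p a ∧ q a ∧ x = f a}) := by
  have hfin : {x : ℝ | ∃ a ∈ A, p a ∧ q a ∧ x = f a}.Finite :=
    (A.finite_toSet.image f).subset fun _ ⟨a, ha, _, _, hx⟩ => ⟨a, ha, hx.symm⟩
  obtain ⟨a, ha, hp, hq⟩ := h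
  have hne : {x : ℝ | ∃ a ∈ A, p a ∧ q a ∧ x = f a}.Nonempty := ⟨f a, a, ha, hp, hq, rfl⟩
  exact ⟨hne.csInf_mem hfin, fun _ hx => csInf_le hfin.bddBelow hx⟩

theorem sq_div_le_sq_iff_one_div_div_sq_le {a g t : ℝ} (hg : 0 < g) (ht : 0 < t) :
    a ^ 2 / t ≤ g ^ 2 ↔ 1 / (g / a) ^ 2 ≤ t := by
  rw [div_pow, one_div_div, div_le_comm₀ ht (by positivity)]


/-- Analysis of the relaxed program (12) in Appendix C of the paper.
With `Δ_(s) = min_{π ∈ A \ {π*}, π s ≠ π* s} μᵀ(π* - π) / |π* s - π s|`: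
(i) a positive `τ` is feasible for the relaxed program (max over differing
coordinates) iff `τ s ≥ 1 / Δ_(s)²` for all `s`;
(ii) the vector `τ' s = 1 / Δ_(s)²` is itself feasible;
(iii) the minimum of `∑ s, τ s` over feasible positive `τ` equals
`∑ s, 1 / Δ_(s)²` (and is thus attained at `τ'`). -/
theorem stmt7 (d : ℕ) (A : Finset (Fin d → ℝ)) (μ πstar : Fin d → ℝ)
    (hπstar : πstar ∈ A)
    (hopt : ∀ π ∈ A, π ≠ πstar → 0 < ∑ e, μ e * (πstar e - π e))
    (hdiff : ∀ s : Fin d, ∃ π ∈ A, π s ≠ πstar s)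
    (Δ : Fin d → ℝ)
    (hΔ : ∀ s, Δ s = sInf {x : ℝ | ∃ π ∈ A, π ≠ πstar ∧ π s ≠ πstar s ∧
        x = (∑ e, μ e * (πstar e - π e)) / |πstar s - π s|}) :
    (∀ τ : Fin d → ℝ, (∀ s, 0 < τ s) →
      ((∀ π ∈ A, π ≠ πstar →
          sSup {x : ℝ | ∃ s : Fin d, π s ≠ πstar s ∧ x = |πstar s - π s| ^ 2 / τ s}
            ≤ (∑ e, μ e * (πstar e - π e)) ^ 2)
        ↔ (∀ s, 1 / Δ s ^ 2 ≤ τ s)))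
    ∧ (∀ π ∈ A, π ≠ πstar →
        sSup {x : ℝ | ∃ s : Fin d, π s ≠ πstar s ∧
            x = |πstar s - π s| ^ 2 / (1 / Δ s ^ 2)}
          ≤ (∑ e, μ e * (πstar e - π e)) ^ 2)
    ∧ IsLeast {y : ℝ | ∃ τ : Fin d → ℝ, (∀ s, 0 < τ s) ∧
        (∀ π ∈ A, π ≠ πstar →
          sSup {x : ℝ | ∃ s : Fin d, π s ≠ πstar s ∧ x = |πstar s - π s| ^ 2 / τ s}
            ≤ (∑ e, μ e * (πstar e - π e)) ^ 2) ∧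
        y = ∑ s, τ s}
      (∑ s, 1 / Δ s ^ 2) := by
  have hleast : ∀ s, IsLeast {x : ℝ | ∃ π ∈ A, π ≠ πstar ∧ π s ≠ πstar s ∧
      x = (∑ e, μ e * (πstar e - π e)) / |πstar s - π s|} (Δ s) := by
    intro s
    obtain ⟨π, hπ, hs⟩ := hdiff s
    rw [hΔ s]
    exact isLeast_sInf_setOf_exists_mem_eq A (· ≠ πstar) (fun π => π s ≠ πstar s) _
      ⟨π, hπ, ne_of_apply_ne (· s) hs, hs⟩
  have hpos : ∀ s, 0 < Δ s := by
    intro s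
    obtain ⟨π, hπ, hne, hs, hx⟩ := (hleast s).1
    rw [hx]
    exact div_pos (hopt π hπ hne) (abs_pos.2 (sub_ne_zero.2 hs.symm))
  have hiff : ∀ τ : Fin d → ℝ, (∀ s, 0 < τ s) →
      ((∀ π ∈ A, π ≠ πstar →
          sSup {x : ℝ | ∃ s : Fin d, π s ≠ πstar s ∧ x = |πstar s - π s| ^ 2 / τ s}
            ≤ (∑ e, μ e * (πstar e - π e)) ^ 2)
        ↔ (∀ s, 1 / Δ s ^ 2 ≤ τ s)) := by
    intro τ hτ
    constructor
    · intro h s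
      obtain ⟨π, hπ, hne, hs, hx⟩ := (hleast s).1
      rw [hx, ← sq_div_le_sq_iff_one_div_div_sq_le (hopt π hπ hne) (hτ s)]
      exact (sSup_setOf_exists_eq_le_iff _ _ (sq_nonneg _)).1 (h π hπ hne) s hs
    · intro h π hπ hne
      refine (sSup_setOf_exists_eq_le_iff _ _ (sq_nonneg _)).2 fun s hs => ?_
      rw [sq_div_le_sq_iff_one_div_div_sq_le (hopt π hπ hne) (hτ s)]
      refine le_trans (one_div_le_one_div_of_le (pow_pos (hpos s) 2) ?_) (h s)
      exact pow_le_pow_left₀ (hpos s).le ((hleast s).2 ⟨π, hπ, hne, hs, rfl⟩) 2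
  have hτpos : ∀ s, 0 < 1 / Δ s ^ 2 := fun s => one_div_pos.2 (pow_pos (hpos s) 2)
  have hfeas := (hiff (fun s => 1 / Δ s ^ 2) hτpos).2 fun _ => le_rfl
  refine ⟨hiff, hfeas, ⟨_, hτpos, hfeas, rfl⟩, ?_⟩
  rintro _ ⟨τ, hτ, hf, rfl⟩
  exact Finset.sum_le_sum fun s _ => (hiff τ hτ).1 hf s
end

section
/- Fix θ ∈ (0,1) and a real number a ≠ 0, and set t = log(1/θ)/(4a²). Let T be a natural number with T ≤ 4t, and let s_1,…,s_T and X_1,…,X_T be real numbers satisfying |Σ_{i=1}^T X_i − Σ_{i=1}^T s_i| ≤ √(t · log(1/θ)). Then Π_{i=1}^T N(X_i | s_i + a, 1)/N(X_i | s_i, 1) ≥ θ, where N(x | m, 1) = (1/√(2π)) exp(−(x−m)²/2) is the density of the Gaussian distribution with mean m and unit variance; equivalently, exp(a · Σ_{i=1}^T (X_i − s_i) − T a²/2) ≥ θ. -/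
/-- The likelihood ratio of two unit-variance Gaussians whose means differ by `a`. -/
lemma gaussian_likelihood_ratio (x m a : ℝ) :
    ((Real.sqrt (2 * Real.pi))⁻¹ * Real.exp (-(x - (m + a)) ^ 2 / 2))
      / ((Real.sqrt (2 * Real.pi))⁻¹ * Real.exp (-(x - m) ^ 2 / 2))
    = Real.exp (a * (x - m) - a ^ 2 / 2) := by
  have hc : (Real.sqrt (2 * Real.pi))⁻¹ ≠ 0 := by positivity
  rw [mul_div_mul_left _ _ hc, ← Real.exp_sub]
  congr 1
  ring


/-- Lemma 2 of the paper (from Chen et al. 2014): for `θ ∈ (0,1)`, `a ≠ 0`,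
`t = log(1/θ)/(4a²)`, a natural number `T ≤ 4t`, and reals `s_i`, `X_i` with
`|∑ X_i - ∑ s_i| ≤ √(t log(1/θ))`, the Gaussian likelihood ratio satisfies
`∏ i, N(X_i | s_i + a, 1) / N(X_i | s_i, 1) ≥ θ`; equivalently
`exp(a ∑ (X_i - s_i) - T a²/2) ≥ θ`. -/
theorem stmt8 (θ : ℝ) (hθ : θ ∈ Set.Ioo (0 : ℝ) 1) (a : ℝ) (ha : a ≠ 0)
    (t : ℝ) (ht : t = Real.log (1 / θ) / (4 * a ^ 2))
    (T : ℕ) (hT : (T : ℝ) ≤ 4 * t)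
    (s X : ℕ → ℝ)
    (hsum : |∑ i ∈ Finset.range T, X i - ∑ i ∈ Finset.range T, s i|
        ≤ Real.sqrt (t * Real.log (1 / θ))) :
    θ ≤ ∏ i ∈ Finset.range T,
        ((Real.sqrt (2 * Real.pi))⁻¹ * Real.exp (-(X i - (s i + a)) ^ 2 / 2))
          / ((Real.sqrt (2 * Real.pi))⁻¹ * Real.exp (-(X i - s i) ^ 2 / 2))
    ∧ θ ≤ Real.exp (a * ∑ i ∈ Finset.range T, (X i - s i) - T * a ^ 2 / 2) := by
  obtain ⟨hθ0, -⟩ := hθ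
  have hexp : θ ≤ Real.exp (a * ∑ i ∈ Finset.range T, (X i - s i) - T * a ^ 2 / 2) := by
    rw [← Real.log_le_iff_le_exp hθ0, Finset.sum_sub_distrib]
    have hlog : Real.log (1 / θ) = -Real.log θ := by rw [one_div, Real.log_inv]
    have ha2 : 0 < a ^ 2 := by positivity
    have hta : 4 * t * a ^ 2 = Real.log (1 / θ) := by
      rw [ht]
      field_simp
    have hTa : T * a ^ 2 ≤ Real.log (1 / θ) :=
      hta ▸ mul_le_mul_of_nonneg_right hT ha2.le
    have hL : 0 ≤ Real.log (1 / θ) := le_trans (by positivity) hTa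
    have hshift : |a * (∑ i ∈ Finset.range T, X i - ∑ i ∈ Finset.range T, s i)|
        ≤ Real.log (1 / θ) / 2 := by
      rw [abs_mul]
      calc _ ≤ |a| * Real.sqrt (t * Real.log (1 / θ)) :=
            mul_le_mul_of_nonneg_left hsum (abs_nonneg a)
        _ = Real.sqrt ((Real.log (1 / θ) / 2) ^ 2) := by
            rw [← Real.sqrt_sq_eq_abs, ← Real.sqrt_mul ha2.le]
            congr 1
            linear_combination Real.log (1 / θ) / 4 * hta
        _ = Real.log (1 / θ) / 2 := Real.sqrt_sq (by positivity)
    linarith [(abs_le.mp hshift).1]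
  refine ⟨?_, hexp⟩
  simpa only [gaussian_likelihood_ratio, ← Real.exp_sum, Finset.sum_sub_distrib,
    ← Finset.mul_sum, Finset.sum_const, Finset.card_range, nsmul_eq_mul, ← mul_div_assoc]
    using hexp
end

section
/- Let A be a finite subset of ℝ^d with |A| ≥ 2, let μ ∈ ℝ^d, and let π* ∈ A satisfy Δ_π := μᵀ(π* − π) > 0 for every π ∈ A \ {π*}. Then the infimum of Σ_{s=1}^d τ_s over all τ : {1,…,d} → ℝ with τ_s > 0 for all s satisfying, for every π ∈ A \ {π*}, Σ_{s=1}^d |π*_s − π_s|²/τ_s ≤ Δ_π², equals ρ* := the infimum over all λ : {1,…,d} → ℝ with λ_s > 0 and Σ_{s=1}^d λ_s = 1 of max over π ∈ A \ {π*} of (Σ_{s=1}^d |π*_s − π_s|²/λ_s)/Δ_π². -/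
/-- If two sets of reals, the second nonempty and the first bounded below, are such that the
second is contained in the first and every element of the first dominates one of the second,
then their infima agree. -/
theorem csInf_eq_of_subset_of_forall_exists_le {S T : Set ℝ} (hT : T.Nonempty)
    (hS : BddBelow S) (hTS : T ⊆ S) (h : ∀ x ∈ S, ∃ y ∈ T, y ≤ x) : sInf S = sInf T :=
  le_antisymm (csInf_le_csInf hS hT hTS) <| le_csInf (hT.mono hTS) fun x hx =>
    let ⟨_, hy, hyx⟩ := h x hx
    csInf_le_of_le (hS.mono hTS) hy hyx

/-- The set of values of a function on the elements of a finset other than `a` is bounded above. -/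
theorem bddAbove_setOf_exists_mem_ne {α : Type*} (A : Finset α) (a : α) (f : α → ℝ) :
    BddAbove {y : ℝ | ∃ x ∈ A, x ≠ a ∧ y = f x} :=
  (A.finite_toSet.image f).bddAbove.mono <| by
    rintro _ ⟨x, hx, -, rfl⟩
    exact ⟨x, hx, rfl⟩

theorem sum_abs_sub_sq_div_pos {ι : Type*} [Fintype ι] {x y w : ι → ℝ} (hw : ∀ s, 0 < w s)
    (hxy : y ≠ x) : 0 < ∑ s, |x s - y s| ^ 2 / w s := by
  obtain ⟨s, hs⟩ := Function.ne_iff.1 hxy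
  refine Finset.sum_pos' (fun s _ => div_nonneg (sq_nonneg _) (hw s).le) ⟨s, Finset.mem_univ s, ?_⟩
  have := abs_pos.2 (sub_ne_zero.2 hs.symm)
  have := hw s
  positivity

theorem sum_div_mul_left {ι : Type*} [Fintype ι] (a w : ι → ℝ) (c : ℝ) :
    ∑ s, a s / (c * w s) = (∑ s, a s / w s) / c := by
  simp_rw [Finset.sum_div, div_div, mul_comm]

/-- The paper's claim that `Low(A)` (the optimal value of program (8)) equals
the transductive-bandit quantity `ρ*` of Fiez et al. (2019): the infimum of
`∑ s, τ s` over positive `τ` with `∑ s, |π*_s - π_s|²/τ_s ≤ Δ_π²` for all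
suboptimal `π`, equals the infimum over probability vectors `λ` of
`max_{π ≠ π*} (∑ s, |π*_s - π_s|²/λ_s) / Δ_π²`. -/
theorem stmt12 (d : ℕ) (A : Finset (Fin d → ℝ)) (hcard : 2 ≤ A.card)
    (μ πstar : Fin d → ℝ) (hπstar : πstar ∈ A)
    (hopt : ∀ π ∈ A, π ≠ πstar → 0 < ∑ e, μ e * (πstar e - π e)) :
    sInf {x : ℝ | ∃ τ : Fin d → ℝ, (∀ s, 0 < τ s) ∧
        (∀ π ∈ A, π ≠ πstar →
          ∑ s, |πstar s - π s| ^ 2 / τ s ≤ (∑ e, μ e * (πstar e - π e)) ^ 2) ∧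
        x = ∑ s, τ s}
    = sInf {x : ℝ | ∃ lam : Fin d → ℝ, (∀ s, 0 < lam s) ∧ (∑ s, lam s = 1) ∧
        x = sSup {y : ℝ | ∃ π ∈ A, π ≠ πstar ∧
          y = (∑ s, |πstar s - π s| ^ 2 / lam s)
                / (∑ e, μ e * (πstar e - π e)) ^ 2}} := by
  obtain ⟨π₀, hπ₀, hne₀⟩ := Finset.exists_mem_ne hcard πstar
  have hd : Nonempty (Fin d) := ⟨(Function.ne_iff.1 hne₀).choose⟩
  apply csInf_eq_of_subset_of_forall_exists_le
  · refine ⟨_, fun _ => (d : ℝ)⁻¹, fun _ => ?_, ?_, rfl⟩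
    · exact inv_pos.2 (Nat.cast_pos.2 (Fin.pos_iff_nonempty.2 hd))
    · have : (d : ℝ) ≠ 0 := Nat.cast_ne_zero.2 (Fin.pos_iff_nonempty.2 hd).ne'
      simp [this]
  · refine ⟨0, ?_⟩
    rintro _ ⟨τ, hτ, -, rfl⟩
    exact Finset.sum_nonneg fun s _ => (hτ s).le
  · rintro _ ⟨lam, hlam, hsum, rfl⟩
    set R := sSup {y : ℝ | ∃ π ∈ A, π ≠ πstar ∧
      y = (∑ s, |πstar s - π s| ^ 2 / lam s) / (∑ e, μ e * (πstar e - π e)) ^ 2}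
    have hle : ∀ π ∈ A, π ≠ πstar →
        (∑ s, |πstar s - π s| ^ 2 / lam s) / (∑ e, μ e * (πstar e - π e)) ^ 2 ≤ R :=
      fun π hπ hne => le_csSup (bddAbove_setOf_exists_mem_ne A πstar _) ⟨π, hπ, hne, rfl⟩
    have hRpos : 0 < R := (div_pos (sum_abs_sub_sq_div_pos hlam hne₀)
      (pow_pos (hopt π₀ hπ₀ hne₀) 2)).trans_le (hle π₀ hπ₀ hne₀)
    refine ⟨fun s => R * lam s, fun s => mul_pos hRpos (hlam s), fun π hπ hne => ?_, ?_⟩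
    · rw [sum_div_mul_left, div_le_comm₀ hRpos (pow_pos (hopt π hπ hne) 2)]
      exact hle π hπ hne
    · rw [← Finset.mul_sum, hsum, mul_one]
  · rintro _ ⟨τ, hτ, hfeas, rfl⟩
    have hT : 0 < ∑ s, τ s := Finset.sum_pos (fun s _ => hτ s) Finset.univ_nonempty
    refine ⟨_, ⟨fun s => (∑ s, τ s)⁻¹ * τ s, fun s => mul_pos (inv_pos.2 hT) (hτ s), ?_, rfl⟩, ?_⟩
    · rw [← Finset.mul_sum, inv_mul_cancel₀ hT.ne']
    · refine csSup_le ⟨_, π₀, hπ₀, hne₀, rfl⟩ ?_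
      rintro _ ⟨π, hπ, hne, rfl⟩
      rw [sum_div_mul_left, div_inv_eq_mul, div_le_iff₀ (pow_pos (hopt π hπ hne) 2), mul_comm]
      exact mul_le_mul_of_nonneg_left (hfeas π hπ hne) hT.le
end
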